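/- arXiv:1102.0040 — 2 statements merged into one kernel-verified Lean document; each statement's English description precedes it below -/
import Mathlib

section
/- Fix an alphabet of size K ≥ 1. For any string w of length m over this alphabet and any n ≥ m, the number of strings of length n over the same alphabet that contain w as a subsequence equals ∑_{i=0}^{n-m} C(n,i)·(K-1)^i; in particular, this count does not depend on w. -/
open Classical in
noncomputable def cntSup (K n : ℕ) (w : List (Fin K)) : ℕ :=
  ∑ x : Fin n → Fin K, if w.Sublist (List.ofFn x) then 1 else 0

theorem cons_sub_iff {α : Type*} [DecidableEq α] (a c : α) (w l : List α) :
    (a :: w).Sublist (c :: l) ↔ if c = a then w.Sublist l else (a :: w).Sublist l := by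
  split_ifs with h
  · subst h; exact List.cons_sublist_cons
  · constructor
    · intro hs
      cases hs with
      | cons _ h' => exact h'
      | cons_cons _ h' => exact absurd rfl h
    · intro hs; exact hs.cons c

theorem cntSup_succ (K n : ℕ) (a : Fin K) (w : List (Fin K)) :
    cntSup K (n + 1) (a :: w) = cntSup K n w + (K - 1) * cntSup K n (a :: w) := by
  classical
  unfold cntSup
  rw [← Equiv.sum_comp (Fin.consEquiv (fun _ => Fin K)), Fintype.sum_prod_type]
  have key : ∀ c : Fin K, (∑ y : Fin n → Fin K,
      if (a :: w).Sublist (List.ofFn (Fin.consEquiv (fun _ => Fin K) (c, y))) then 1 else 0)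
      = if c = a then cntSup K n w else cntSup K n (a :: w) := by
    intro c
    have e : ∀ y : Fin n → Fin K,
        List.ofFn (Fin.consEquiv (fun _ => Fin K) (c, y)) = c :: List.ofFn y := by
      intro y
      simp [Fin.consEquiv, List.ofFn_succ]
    simp only [e, cons_sub_iff]
    unfold cntSup
    by_cases h : c = a <;> simp [h]
  rw [Finset.sum_congr rfl (fun c _ => key c)]
  rw [← Finset.add_sum_erase _ _ (Finset.mem_univ a)]
  rw [Finset.sum_congr rfl (g := fun _ => cntSup K n (a :: w))
    (fun c hc => by rw [if_neg (Finset.ne_of_mem_erase hc)])]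
  simp [cntSup, Finset.card_erase_of_mem]

theorem sum_rec (n j q : ℕ) :
    ∑ i ∈ Finset.range (j + 1), (n + 1).choose i * q ^ i =
      ∑ i ∈ Finset.range (j + 1), n.choose i * q ^ i +
        q * ∑ i ∈ Finset.range j, n.choose i * q ^ i := by
  rw [Finset.sum_range_succ', Finset.sum_range_succ' _ j, Finset.mul_sum]
  have : ∀ i, (n + 1).choose (i + 1) * q ^ (i + 1) =
      n.choose (i + 1) * q ^ (i + 1) + q * (n.choose i * q ^ i) := by
    intro i; rw [Nat.choose_succ_succ]; ring
  simp only [this, Finset.sum_add_distrib, Nat.choose_zero_right]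
  ring

theorem cntSup_eq (K : ℕ) (hK : 1 ≤ K) (n : ℕ) (w : List (Fin K)) :
    cntSup K n w = ∑ i ∈ Finset.range (n + 1 - w.length), n.choose i * (K - 1) ^ i := by
  induction n generalizing w with
  | zero => cases w <;> simp [cntSup]
  | succ n ih =>
    cases w with
    | nil =>
      have := add_pow (K - 1) 1 (n + 1)
      rw [Nat.sub_add_cancel hK] at this
      simp only [one_pow, mul_one] at this
      simp [cntSup, this, mul_comm]
    | cons a w =>
      rw [cntSup_succ, ih, ih]
      simp only [List.length_cons]
      rcases Nat.lt_or_ge n w.length with h | h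
      · rw [show n + 1 + 1 - (w.length + 1) = 0 by omega, show n + 1 - w.length = 0 by omega,
          show n + 1 - (w.length + 1) = 0 by omega]
        simp
      · obtain ⟨j, rfl⟩ := Nat.exists_eq_add_of_le h
        rw [show w.length + j + 1 + 1 - (w.length + 1) = j + 1 by omega,
          show w.length + j + 1 - w.length = j + 1 by omega,
          show w.length + j + 1 - (w.length + 1) = j by omega, sum_rec]

/-- Fix an alphabet of size K ≥ 1. For any string w of length m over
this alphabet and any n ≥ m, the number of strings of length n over the same
alphabet that contain w as a subsequence equals ∑_{i=0}^{n-m} C(n,i)·(K-1)^i. -/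
theorem stmt_2 (K : ℕ) (hK : 1 ≤ K) (n : ℕ) (w : List (Fin K)) (h : w.length ≤ n) :
    Nat.card {x : Fin n → Fin K // w.Sublist (List.ofFn x)} =
      ∑ i ∈ Finset.range (n - w.length + 1), n.choose i * (K - 1) ^ i := by
  classical
  rw [← Nat.sub_add_comm h, ← cntSup_eq K hK, Nat.card_eq_fintype_card, Fintype.card_subtype]
  simp [cntSup]
end

section
/- Fix q ∈ (0,1) and let L^q_n denote the expected length of the longest common subsequence of two independent binary strings of length n, each drawn from the symmetric first-order Markov distribution with parameter q. Then the sequence (L^q_n) is superadditive (L^q_{m+n} ≥ L^q_m + L^q_n for all m, n ≥ 1), and consequently there exists a constant γ_q ∈ [0,1] such that L^q_n/n converges to γ_q as n → ∞. -/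
/-- The length of the longest common subsequence of two lists. -/
noncomputable def lcsLen (x y : List Bool) : ℕ :=
  sSup {m : ℕ | ∃ z : List Bool, z.Sublist x ∧ z.Sublist y ∧ z.length = m}

/-- `delta l` is the number of adjacent positions of the list `l` holding
different values. -/
def delta : List Bool → ℕ
  | [] => 0
  | [_] => 0
  | a :: b :: t => (if a ≠ b then 1 else 0) + delta (b :: t)

/-- The symmetric first-order Markov distribution with parameter q assigns a string
s of length n the probability (1/2)·q^{n-1-Δ(s)}·(1-q)^{Δ(s)}. -/
noncomputable def markovP (q : ℝ) {n : ℕ} (s : Fin n → Bool) : ℝ :=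
  (1 / 2 : ℝ) * q ^ (n - 1 - delta (List.ofFn s)) * (1 - q) ^ (delta (List.ofFn s))

/-- `expLCSMarkov q n` is the expected LCS length of two independent strings of
length n, each drawn from the symmetric first-order Markov distribution with
parameter q. -/
noncomputable def expLCSMarkov (q : ℝ) (n : ℕ) : ℝ :=
  ∑ x : Fin n → Bool, ∑ y : Fin n → Bool,
    markovP q x * markovP q y * (lcsLen (List.ofFn x) (List.ofFn y) : ℝ)

/-- Transition weight of a list. -/
noncomputable def wt (q : ℝ) : List Bool → ℝ
  | [] => 1
  | [_] => 1
  | a :: b :: t => (if a ≠ b then 1 - q else q) * wt q (b :: t)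

lemma delta_le (a : Bool) (l : List Bool) : delta (a :: l) ≤ l.length := by
  induction l generalizing a with
  | nil => simp [delta]
  | cons b t ih =>
    have := ih b
    simp only [delta, List.length_cons]
    split_ifs <;> omega

lemma wt_cons_eq (q : ℝ) (a : Bool) (l : List Bool) :
    wt q (a :: l) = q ^ (l.length - delta (a :: l)) * (1 - q) ^ (delta (a :: l)) := by
  induction l generalizing a with
  | nil => simp [delta, wt]
  | cons b t ih =>
    have h := delta_le b t
    simp only [delta, wt, ih b, List.length_cons]
    split_ifs
    · rw [show t.length + 1 - (1 + delta (b :: t)) = t.length - delta (b :: t) by omega, pow_add]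
      ring
    · rw [show t.length + 1 - (0 + delta (b :: t)) = (t.length - delta (b :: t)) + 1 by omega,
        pow_succ, zero_add]
      ring

lemma markovP_eq (q : ℝ) {n : ℕ} (hn : 1 ≤ n) (s : Fin n → Bool) :
    markovP q s = 1 / 2 * wt q (List.ofFn s) := by
  obtain ⟨k, rfl⟩ : ∃ k, n = k + 1 := ⟨n - 1, by omega⟩
  unfold markovP
  rw [List.ofFn_succ, wt_cons_eq]
  simp [mul_assoc]

lemma wt_nonneg (q : ℝ) (hq : q ∈ Set.Ioo (0 : ℝ) 1) (l : List Bool) : 0 ≤ wt q l := by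
  cases l with
  | nil => simp [wt]
  | cons a t =>
    rw [wt_cons_eq]
    have := hq.1.le
    have := sub_nonneg.2 hq.2.le
    positivity

lemma sum_cons (q : ℝ) (l : List Bool) (hl : l ≠ []) : ∑ c : Bool, wt q (c :: l) = wt q l := by
  cases l with
  | nil => exact absurd rfl hl
  | cons b t => cases b <;> simp [wt] <;> ring

lemma sum_snoc (q : ℝ) (l : List Bool) (hl : l ≠ []) :
    ∑ c : Bool, wt q (l ++ [c]) = wt q l := by
  induction l with
  | nil => exact absurd rfl hl
  | cons a t ih =>
    cases t with
    | nil => cases a <;> simp [wt]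
    | cons b t =>
      have := ih (by simp)
      simp only [List.cons_append, wt] at this ⊢
      rw [← Finset.mul_sum, this]

lemma sum_left (q : ℝ) (l : List Bool) (hl : l ≠ []) (m : ℕ) :
    ∑ a : Fin m → Bool, wt q (List.ofFn a ++ l) = wt q l := by
  induction m with
  | zero => simp
  | succ k ih =>
    rw [← (Fin.consEquiv (fun _ => Bool)).sum_comp, Fintype.sum_prod_type, Finset.sum_comm, ← ih]
    refine Finset.sum_congr rfl fun a _ => ?_
    rw [← sum_cons q (List.ofFn a ++ l) (by simp [hl])]
    refine Finset.sum_congr rfl fun c _ => ?_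
    simp [Fin.consEquiv, List.ofFn_succ]

lemma sum_right (q : ℝ) (l : List Bool) (hl : l ≠ []) (m : ℕ) :
    ∑ a : Fin m → Bool, wt q (l ++ List.ofFn a) = wt q l := by
  induction m with
  | zero => simp
  | succ k ih =>
    rw [← (Fin.snocEquiv (fun _ => Bool)).sum_comp, Fintype.sum_prod_type, Finset.sum_comm, ← ih]
    refine Finset.sum_congr rfl fun a _ => ?_
    rw [← sum_snoc q (l ++ List.ofFn a) (by simp [hl])]
    refine Finset.sum_congr rfl fun c _ => ?_
    rw [List.ofFn_succ']
    simp [Fin.snocEquiv, -List.ofFn_succ]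

lemma markovP_nonneg (q : ℝ) (hq : q ∈ Set.Ioo (0 : ℝ) 1) {n : ℕ} (s : Fin n → Bool) :
    0 ≤ markovP q s := by
  have := hq.1.le
  have := sub_nonneg.2 hq.2.le
  unfold markovP
  positivity

lemma marg_right (q : ℝ) {m n : ℕ} (hm : 1 ≤ m) (a : Fin m → Bool) :
    ∑ b : Fin n → Bool, markovP q (Fin.append a b) = markovP q a := by
  rw [markovP_eq q hm, ← sum_right q (List.ofFn a) (by simp; omega) n, Finset.mul_sum]
  refine Finset.sum_congr rfl fun b _ => ?_
  rw [markovP_eq q (by omega), List.ofFn_fin_append]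

lemma marg_left (q : ℝ) {m n : ℕ} (hn : 1 ≤ n) (b : Fin n → Bool) :
    ∑ a : Fin m → Bool, markovP q (Fin.append a b) = markovP q b := by
  rw [markovP_eq q hn, ← sum_left q (List.ofFn b) (by simp; omega) m, Finset.mul_sum]
  refine Finset.sum_congr rfl fun b _ => ?_
  rw [markovP_eq q (by omega), List.ofFn_fin_append]

lemma total (q : ℝ) {n : ℕ} (hn : 1 ≤ n) : ∑ a : Fin n → Bool, markovP q a = 1 := by
  obtain ⟨k, rfl⟩ : ∃ k, n = k + 1 := ⟨n - 1, by omega⟩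
  rw [← (Fin.appendEquiv k 1).sum_comp, Fintype.sum_prod_type, Finset.sum_comm]
  have : ∀ b : Fin 1 → Bool, ∑ a : Fin k → Bool, markovP q (Fin.appendEquiv k 1 (a, b)) = 1 / 2 := by
    intro b
    refine (marg_left q le_rfl b).trans ?_
    rw [markovP_eq q le_rfl]
    simp [wt]
  simp [this]

lemma lcs_bdd (x y : List Bool) :
    BddAbove {m : ℕ | ∃ z : List Bool, z.Sublist x ∧ z.Sublist y ∧ z.length = m} :=
  ⟨x.length, by rintro m ⟨z, h, -, rfl⟩; exact h.length_le⟩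

lemma lcs_mem (x y : List Bool) :
    ∃ z : List Bool, z.Sublist x ∧ z.Sublist y ∧ z.length = lcsLen x y :=
  Nat.sSup_mem
    (s := {m : ℕ | ∃ z : List Bool, z.Sublist x ∧ z.Sublist y ∧ z.length = m})
    ⟨0, [], by simp⟩ (lcs_bdd x y)

lemma lcs_le (x y : List Bool) : lcsLen x y ≤ x.length := by
  obtain ⟨z, h, -, h'⟩ := lcs_mem x y
  exact h' ▸ h.length_le

lemma lcs_append (x y x' y' : List Bool) :
    lcsLen x y + lcsLen x' y' ≤ lcsLen (x ++ x') (y ++ y') := by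
  obtain ⟨z, h1, h2, h3⟩ := lcs_mem x y
  obtain ⟨z', h1', h2', h3'⟩ := lcs_mem x' y'
  exact le_csSup (lcs_bdd _ _) ⟨z ++ z', h1.append h1', h2.append h2', by simp [h3, h3']⟩

lemma exp_nonneg (q : ℝ) (hq : q ∈ Set.Ioo (0 : ℝ) 1) (n : ℕ) : 0 ≤ expLCSMarkov q n :=
  Finset.sum_nonneg fun x _ => Finset.sum_nonneg fun y _ =>
    mul_nonneg (mul_nonneg (markovP_nonneg q hq x) (markovP_nonneg q hq y)) (Nat.cast_nonneg _)

lemma exp_zero (q : ℝ) : expLCSMarkov q 0 = 0 := by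
  have : lcsLen [] [] = 0 := by simpa using lcs_le [] []
  simp [expLCSMarkov, this]

lemma exp_le (q : ℝ) (hq : q ∈ Set.Ioo (0 : ℝ) 1) (n : ℕ) : expLCSMarkov q n ≤ n := by
  rcases Nat.eq_zero_or_pos n with rfl | hn
  · simp [exp_zero]
  calc expLCSMarkov q n ≤ ∑ x : Fin n → Bool, ∑ y : Fin n → Bool,
        markovP q x * markovP q y * (n : ℝ) := by
        refine Finset.sum_le_sum fun x _ => Finset.sum_le_sum fun y _ => ?_
        refine mul_le_mul_of_nonneg_left ?_
          (mul_nonneg (markovP_nonneg q hq x) (markovP_nonneg q hq y))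
        exact_mod_cast (lcs_le _ _).trans (by simp)
    _ = n := by
        simp_rw [← Finset.sum_mul, ← Finset.mul_sum, total q hn, mul_one, total q hn, one_mul]

lemma superadd (q : ℝ) (hq : q ∈ Set.Ioo (0 : ℝ) 1) (m n : ℕ) (hm : 1 ≤ m) (hn : 1 ≤ n) :
    expLCSMarkov q m + expLCSMarkov q n ≤ expLCSMarkov q (m + n) := by
  have key : ∀ F : (Fin (m + n) → Bool) → ℝ, ∑ x, F x =
      ∑ a : Fin m → Bool, ∑ b : Fin n → Bool, F (Fin.append a b) := by
    intro F
    rw [← (Fin.appendEquiv m n).sum_comp, Fintype.sum_prod_type]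
    rfl
  have e1 : expLCSMarkov q m = ∑ a : Fin m → Bool, ∑ b : Fin n → Bool,
      ∑ a' : Fin m → Bool, ∑ b' : Fin n → Bool,
      markovP q (Fin.append a b) * markovP q (Fin.append a' b') *
        (lcsLen (List.ofFn a) (List.ofFn a') : ℝ) := by
    unfold expLCSMarkov
    refine Finset.sum_congr rfl fun a _ => ?_
    rw [Finset.sum_comm]
    refine Finset.sum_congr rfl fun a' _ => ?_
    simp_rw [← Finset.sum_mul, ← Finset.mul_sum, marg_right q hm, ← Finset.sum_mul,
      marg_right q hm]
  have e2 : expLCSMarkov q n = ∑ a : Fin m → Bool, ∑ b : Fin n → Bool,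
      ∑ a' : Fin m → Bool, ∑ b' : Fin n → Bool,
      markovP q (Fin.append a b) * markovP q (Fin.append a' b') *
        (lcsLen (List.ofFn b) (List.ofFn b') : ℝ) := by
    unfold expLCSMarkov
    symm
    rw [Finset.sum_comm]
    refine Finset.sum_congr rfl fun b _ => ?_
    have : ∀ a : Fin m → Bool, ∑ a' : Fin m → Bool, ∑ b' : Fin n → Bool,
      markovP q (Fin.append a b) * markovP q (Fin.append a' b') *
        (lcsLen (List.ofFn b) (List.ofFn b') : ℝ) = ∑ b' : Fin n → Bool,
        markovP q (Fin.append a b) * markovP q b' *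
        (lcsLen (List.ofFn b) (List.ofFn b') : ℝ) := by
      intro a
      rw [Finset.sum_comm]
      refine Finset.sum_congr rfl fun b' _ => ?_
      rw [← Finset.sum_mul, ← Finset.mul_sum, marg_left q hn]
    simp_rw [this]
    rw [Finset.sum_comm]
    refine Finset.sum_congr rfl fun b' _ => ?_
    rw [← Finset.sum_mul, ← Finset.sum_mul, marg_left q hn]
  have e3 : expLCSMarkov q (m + n) = ∑ a : Fin m → Bool, ∑ b : Fin n → Bool,
      ∑ a' : Fin m → Bool, ∑ b' : Fin n → Bool,
      markovP q (Fin.append a b) * markovP q (Fin.append a' b') *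
        (lcsLen (List.ofFn a ++ List.ofFn b) (List.ofFn a' ++ List.ofFn b') : ℝ) := by
    unfold expLCSMarkov
    simp_rw [key, List.ofFn_fin_append]
  rw [e1, e2, e3]
  simp_rw [← Finset.sum_add_distrib, ← mul_add]
  refine Finset.sum_le_sum fun a _ => Finset.sum_le_sum fun b _ =>
    Finset.sum_le_sum fun a' _ => Finset.sum_le_sum fun b' _ => ?_
  refine mul_le_mul_of_nonneg_left ?_
    (mul_nonneg (markovP_nonneg q hq _) (markovP_nonneg q hq _))
  exact_mod_cast lcs_append _ _ _ _

/-- For q ∈ (0,1), the sequence (L^q_n) is superadditive, and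
consequently there is γ_q ∈ [0,1] with L^q_n/n → γ_q. -/
theorem stmt_14 (q : ℝ) (hq : q ∈ Set.Ioo (0 : ℝ) 1) :
    (∀ m n : ℕ, 1 ≤ m → 1 ≤ n →
        expLCSMarkov q m + expLCSMarkov q n ≤ expLCSMarkov q (m + n)) ∧
      ∃ γq : ℝ, γq ∈ Set.Icc (0 : ℝ) 1 ∧
        Filter.Tendsto (fun n : ℕ => expLCSMarkov q n / n) Filter.atTop (nhds γq) := by
  refine ⟨superadd q hq, ?_⟩
  have hs : Subadditive (fun n => - expLCSMarkov q n) := by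
    intro m n
    rcases Nat.eq_zero_or_pos m with rfl | hm
    · simp [exp_zero]
    rcases Nat.eq_zero_or_pos n with rfl | hn
    · simp [exp_zero]
    have := superadd q hq m n hm hn
    linarith
  have hI : ∀ n : ℕ, expLCSMarkov q n / n ∈ Set.Icc (0 : ℝ) 1 := fun n =>
    ⟨div_nonneg (exp_nonneg q hq n) n.cast_nonneg,
      div_le_one_of_le₀ (exp_le q hq n) n.cast_nonneg⟩
  have hb : BddBelow (Set.range fun n : ℕ => - expLCSMarkov q n / n) := by
    refine ⟨-1, ?_⟩
    rintro _ ⟨n, rfl⟩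
    have := (hI n).2
    simp only [neg_div]
    linarith
  have ht := (hs.tendsto_lim hb).neg
  simp only [neg_div, neg_neg] at ht
  exact ⟨_, isClosed_Icc.mem_of_tendsto ht (Filter.Eventually.of_forall hI), ht⟩
end
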